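/- arXiv:2304.09619 — 4 statements merged into one kernel-verified Lean document; each statement's English description precedes it below -/
import Mathlib

section
/- Let u ∈ ℝ³ be a unit vector and let ε ∈ (0, π/2). Set A = {g ∈ SO(3,ℝ) : ∠(u, g·u) ≤ π/2 − ε}. Then A·A = {g ∈ SO(3,ℝ) : ∠(u, g·u) ≤ π − 2ε}. -/
open MeasureTheory InnerProductGeometry Real
open scoped Pointwise

/-- `SO(3,ℝ)`: the subgroup of the real orthogonal group `{Q : QᵀQ = QQᵀ = 1}` consisting of the
matrices of determinant `1`, as a compact topological group (with the Borel σ-algebra). -/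
def SO3 : Subgroup ↥(Matrix.orthogonalGroup (Fin 3) ℝ) where
  carrier := {g | (g : Matrix (Fin 3) (Fin 3) ℝ).det = 1}
  one_mem' := by simp
  mul_mem' := by
    intro a b ha hb
    simp only [Set.mem_setOf_eq, Submonoid.coe_mul, Matrix.det_mul] at *
    rw [ha, hb, mul_one]
  inv_mem' := by
    intro a ha
    simp only [Set.mem_setOf_eq] at *
    have h : ((a⁻¹ : ↥(Matrix.orthogonalGroup (Fin 3) ℝ)) : Matrix (Fin 3) (Fin 3) ℝ)
        = star (a : Matrix (Fin 3) (Fin 3) ℝ) := rfl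
    rw [h, Matrix.star_eq_conjTranspose, Matrix.det_conjTranspose, ha, star_one]

noncomputable instance : MeasurableSpace ↥SO3 := borel _
instance : BorelSpace ↥SO3 := ⟨rfl⟩

/-- The action of an element of `SO(3,ℝ)` on `ℝ³` by matrix–vector multiplication. -/
noncomputable def SO3.act (g : ↥SO3) (u : EuclideanSpace ℝ (Fin 3)) : EuclideanSpace ℝ (Fin 3) :=
  Matrix.toEuclideanLin ((g : ↥(Matrix.orthogonalGroup (Fin 3) ℝ)) : Matrix (Fin 3) (Fin 3) ℝ) u

/-- The action of `SO(3,ℝ)` is compatible with multiplication. -/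
theorem SO3.act_mul (g h : ↥SO3) (u : EuclideanSpace ℝ (Fin 3)) :
    SO3.act (g * h) u = SO3.act g (SO3.act h u) := by
  simp [SO3.act]

/-- `SO(3,ℝ)` preserves the inner product. -/
theorem SO3.inner_act_act (g : ↥SO3) (u v : EuclideanSpace ℝ (Fin 3)) :
    inner ℝ (SO3.act g u) (SO3.act g v) = inner ℝ u v := by
  have h := (Matrix.mem_orthogonalGroup_iff' (Fin 3) ℝ).mp g.1.2
  rw [SO3.act, SO3.act, ← LinearMap.adjoint_inner_right,
    ← Matrix.toEuclideanLin_conjTranspose_eq_adjoint, ← LinearMap.comp_apply,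
    ← Matrix.toLpLin_mul_same, Matrix.conjTranspose_eq_transpose_of_trivial, h, Matrix.toLpLin_one,
    LinearMap.id_apply]

/-- `SO(3,ℝ)` preserves the Euclidean norm. -/
theorem SO3.norm_act (g : ↥SO3) (u : EuclideanSpace ℝ (Fin 3)) : ‖SO3.act g u‖ = ‖u‖ := by
  rw [norm_eq_sqrt_real_inner, SO3.inner_act_act, ← norm_eq_sqrt_real_inner]

/-- `SO(3,ℝ)` preserves angles. -/
theorem SO3.angle_act_act (g : ↥SO3) (u v : EuclideanSpace ℝ (Fin 3)) :
    angle (SO3.act g u) (SO3.act g v) = angle u v := by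
  simp only [angle, SO3.inner_act_act, SO3.norm_act]

/-- The matrix `k p pᵀ - 1` with `k ‖p‖² = 2` is orthogonal. -/
theorem smul_vecMulVec_sub_one_mem_orthogonalGroup {n : Type*} [Fintype n] [DecidableEq n]
    (p : n → ℝ) (k : ℝ) (hk : k * (p ⬝ᵥ p) = 2) :
    k • Matrix.vecMulVec p p - 1 ∈ Matrix.orthogonalGroup n ℝ := by
  have hP : k • (Matrix.vecMulVec p p * Matrix.vecMulVec p p) = (2 : ℝ) • Matrix.vecMulVec p p := by
    rw [Matrix.vecMulVec_mul_vecMulVec, Matrix.vecMulVec_smul, smul_smul, hk]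
  rw [Matrix.mem_orthogonalGroup_iff, ← Matrix.conjTranspose_eq_transpose_of_trivial]
  simp only [Matrix.conjTranspose_sub, Matrix.conjTranspose_smul, Matrix.conjTranspose_one,
    Matrix.conjTranspose_vecMulVec, star_trivial, sub_mul, mul_sub, Matrix.smul_mul,
    Matrix.mul_smul, hP, one_mul, mul_one]
  module

/-- For every nonzero `p`, the half-turn `x ↦ (2⟨p,x⟩/‖p‖²) p - x` is in `SO(3,ℝ)`. -/
theorem SO3.exists_act_eq_halfTurn {p : EuclideanSpace ℝ (Fin 3)} (hp : p ≠ 0) :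
    ∃ g : ↥SO3, ∀ x, SO3.act g x = (2 * inner ℝ p x / ‖p‖ ^ 2) • p - x := by
  have hp' : ‖p‖ ^ 2 ≠ 0 := by simpa using hp
  obtain ⟨k, hk⟩ : ∃ k, k = 2 / ‖p‖ ^ 2 := ⟨_, rfl⟩
  have hkp : k * (p.ofLp ⬝ᵥ p.ofLp) = 2 := by
    have : ‖p‖ ^ 2 = p.ofLp ⬝ᵥ p.ofLp := by
      simp [EuclideanSpace.real_norm_sq_eq, dotProduct, ← sq]
    rw [hk, ← this, div_mul_cancel₀ _ hp']
  have hdet : (k • Matrix.vecMulVec p.ofLp p.ofLp - 1).det = 1 := by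
    simp only [dotProduct, Fin.sum_univ_three] at hkp
    simp [Matrix.det_fin_three, Matrix.vecMulVec_apply]
    linear_combination hkp
  refine ⟨⟨⟨_, smul_vecMulVec_sub_one_mem_orthogonalGroup p.ofLp k hkp⟩, hdet⟩, fun x ↦ ?_⟩
  have hc : 2 * inner ℝ p x / ‖p‖ ^ 2 = k * inner ℝ p x := by rw [hk]; ring
  rw [hc]
  ext i
  simp [SO3.act, Matrix.vecMulVec_mulVec,
    PiLp.inner_apply, dotProduct, Fin.sum_univ_three]
  ring

/-- A rotation carries any unit vector to any other unit vector that is not antipodal to it. -/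
theorem SO3.exists_act_eq {u w : EuclideanSpace ℝ (Fin 3)} (hu : ‖u‖ = 1) (hw : ‖w‖ = 1)
    (huw : u + w ≠ 0) : ∃ g : ↥SO3, SO3.act g u = w := by
  obtain ⟨g, hg⟩ := SO3.exists_act_eq_halfTurn huw
  have hn : ‖u + w‖ ^ 2 ≠ 0 := by simpa using huw
  have h : 2 * inner ℝ (u + w) u = ‖u + w‖ ^ 2 := by
    rw [norm_add_sq_real, inner_add_left, real_inner_self_eq_norm_sq, real_inner_comm, hu, hw]
    ring
  refine ⟨g, ?_⟩
  rw [hg, h, div_self hn, one_smul, add_sub_cancel_left]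

/-- The sum of two vectors of equal norm bisects the angle between them. -/
theorem angle_self_add_eq_half_angle {V : Type*} [NormedAddCommGroup V] [InnerProductSpace ℝ V]
    {x y : V} (h : ‖x‖ = ‖y‖) (hy : y ≠ 0) : angle x (x + y) = angle x y / 2 := by
  have hsymm : angle x (x + y) = angle y (x + y) := by
    simp only [angle, inner_add_right, real_inner_self_eq_norm_sq, h, real_inner_comm x y,
      add_comm]
  linarith [angle_eq_angle_add_add_angle_add x hy]

/-- For a unit vector u and ε ∈ (0, π/2), the square of A = {g : ∠(u, g·u) ≤ π/2 − ε} is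
exactly {g : ∠(u, g·u) ≤ π − 2ε}. -/
theorem SO3_cap_square (u : EuclideanSpace ℝ (Fin 3)) (hu : ‖u‖ = 1)
    (ε : ℝ) (hε₀ : 0 < ε) (hε₁ : ε < π / 2) :
    {g : ↥SO3 | angle u (SO3.act g u) ≤ π / 2 - ε} *
        {g : ↥SO3 | angle u (SO3.act g u) ≤ π / 2 - ε} =
      {g : ↥SO3 | angle u (SO3.act g u) ≤ π - 2 * ε} := by
  apply Set.Subset.antisymm
  · rintro _ ⟨a, ha, b, hb, rfl⟩
    simp only [Set.mem_ofPred_eq] at ha hb ⊢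
    have htri := angle_le_angle_add_angle u (SO3.act a u) (SO3.act (a * b) u)
    have hab : angle (SO3.act a u) (SO3.act (a * b) u) = angle u (SO3.act b u) := by
      rw [SO3.act_mul, SO3.angle_act_act]
    linarith
  · intro g hg
    simp only [Set.mem_ofPred_eq] at hg
    set v := SO3.act g u with hv
    have hvn : ‖v‖ = 1 := by rw [hv, SO3.norm_act, hu]
    have hu0 : u ≠ 0 := by rintro rfl; simp at hu
    have hv0 : v ≠ 0 := by intro h; simp [h] at hvn
    have huv : u + v ≠ 0 := by
      intro h
      rw [← neg_eq_of_add_eq_zero_right h, angle_self_neg_of_nonzero hu0] at hg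
      linarith
    have hpos : 0 < ‖u + v‖⁻¹ := inv_pos.mpr (norm_pos_iff.mpr huv)
    set w := ‖u + v‖⁻¹ • (u + v) with hw
    have hwn : ‖w‖ = 1 := norm_smul_inv_norm (𝕜 := ℝ) huv
    have huw : angle u w = angle u v / 2 := by
      rw [hw, angle_smul_right_of_pos _ _ hpos, angle_self_add_eq_half_angle (by rw [hu, hvn]) hv0]
    have hwv : angle w v = angle u v / 2 := by
      rw [hw, angle_smul_left_of_pos _ _ hpos, angle_comm, add_comm,
        angle_self_add_eq_half_angle (by rw [hu, hvn]) hu0, angle_comm]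
    have huw0 : u + w ≠ 0 := by
      intro h
      rw [← neg_eq_of_add_eq_zero_right h, angle_self_neg_of_nonzero hu0] at huw
      linarith
    obtain ⟨a, ha⟩ := SO3.exists_act_eq hu hwn huw0
    refine ⟨a, ?_, a⁻¹ * g, ?_, mul_inv_cancel_left a g⟩
    · rw [Set.mem_ofPred_eq, ha, huw]
      linarith
    · rw [Set.mem_ofPred_eq, ← SO3.angle_act_act a, ← SO3.act_mul, mul_inv_cancel_left, ha, ← hv,
        hwv]
      linarith
end

section
/- Let u ∈ ℝ³ be a unit vector, let θ ∈ (0, π/2], and set A = {g ∈ SO(3,ℝ) : ∠(u, g·u) < θ}. Then μ(A·A) = 4·μ(A)·(1 − μ(A)); in particular μ(A·A) < 4·μ(A). -/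
open MeasureTheory InnerProductGeometry Real
open scoped Pointwise

lemma volume_setOf_norm_sq_lt (a : ℝ) :
    volume {y : EuclideanSpace ℝ (Fin 2) | ‖y‖ ^ 2 < a} = ENNReal.ofReal (π * a) := by
  rcases le_or_gt a 0 with ha | ha
  · have : {y : EuclideanSpace ℝ (Fin 2) | ‖y‖ ^ 2 < a} = ∅ := by
      ext y
      simpa using ha.trans (sq_nonneg ‖y‖)
    rw [this, measure_empty, ENNReal.ofReal_of_nonpos (mul_nonpos_of_nonneg_of_nonpos pi_pos.le ha)]
  · have : {y : EuclideanSpace ℝ (Fin 2) | ‖y‖ ^ 2 < a} = Metric.ball 0 √a := by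
      ext y
      simp [Real.lt_sqrt (norm_nonneg y)]
    rw [this, EuclideanSpace.volume_ball_fin_two, ← ENNReal.ofReal_pow (sqrt_nonneg a),
      sq_sqrt ha.le, ← ENNReal.ofReal_mul ha.le, mul_comm]

/-- The first coordinate and the vector of the two remaining ones. -/
noncomputable def coordSplit (x : EuclideanSpace ℝ (Fin 3)) : ℝ × EuclideanSpace ℝ (Fin 2) :=
  (x 0, WithLp.toLp 2 fun j => x j.succ)

lemma measurePreserving_coordSplit : MeasurePreserving coordSplit :=
  ((MeasurePreserving.id volume).prod (PiLp.volume_preserving_toLp (Fin 2))).comp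
    ((volume_preserving_piFinSuccAbove (fun _ : Fin 3 => ℝ) 0).comp
      (PiLp.volume_preserving_ofLp (Fin 3)))

lemma norm_sq_eq_coordSplit (x : EuclideanSpace ℝ (Fin 3)) :
    ‖x‖ ^ 2 = (coordSplit x).1 ^ 2 + ‖(coordSplit x).2‖ ^ 2 := by
  simp [EuclideanSpace.norm_sq_eq, coordSplit, Fin.sum_univ_succ]

/-- The volume of the part of the unit ball of `ℝ³` within a cone about the first axis. -/
lemma volume_sector_axis {c : ℝ} (hc₀ : 0 ≤ c) (hc₁ : c ≤ 1) :
    volume {x : EuclideanSpace ℝ (Fin 3) | ‖x‖ < 1 ∧ c * ‖x‖ < x 0} =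
      ENNReal.ofReal (2 * π / 3 * (1 - c)) := by
  set T : Set (ℝ × EuclideanSpace ℝ (Fin 2)) :=
    {p | p.1 ^ 2 + ‖p.2‖ ^ 2 < 1 ∧ 0 < p.1 ∧ c ^ 2 * (p.1 ^ 2 + ‖p.2‖ ^ 2) < p.1 ^ 2} with hT
  have hTm : MeasurableSet T := by
    refine IsOpen.measurableSet ?_
    refine (isOpen_lt ?_ ?_).and ((isOpen_lt ?_ ?_).and (isOpen_lt ?_ ?_)) <;> fun_prop
  have hpre : {x : EuclideanSpace ℝ (Fin 3) | ‖x‖ < 1 ∧ c * ‖x‖ < x 0} = coordSplit ⁻¹' T := by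
    ext x
    simp only [hT, Set.mem_ofPred_eq, Set.mem_preimage, ← norm_sq_eq_coordSplit, ← mul_pow]
    have h0 : (coordSplit x).1 = x 0 := rfl
    have h1 : 0 ≤ c * ‖x‖ := by positivity
    rw [h0, sq_lt_one_iff₀ (norm_nonneg x)]
    refine and_congr_right fun _ => ⟨fun h => ⟨h1.trans_lt h, by gcongr⟩, fun h => ?_⟩
    exact lt_of_pow_lt_pow_left₀ 2 h.1.le h.2
  have hslice (t : ℝ) : volume (Prod.mk t ⁻¹' T) =
      (Set.Ioc 0 c).indicator (fun t => ENNReal.ofReal (π * ((1 - c ^ 2) / c ^ 2 * t ^ 2))) t +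
      (Set.Ioc c 1).indicator (fun t => ENNReal.ofReal (π * (1 - t ^ 2))) t := by
    rcases le_or_gt t 0 with ht | ht
    · have : Prod.mk t ⁻¹' T = ∅ := by
        ext y
        simp only [hT, Set.mem_preimage, Set.mem_ofPred_eq, Set.mem_empty_iff_false, iff_false]
        intro h
        linarith [h.2.1]
      rw [this, Set.indicator_of_notMem (fun h => ht.not_gt h.1),
        Set.indicator_of_notMem (fun h => (ht.trans hc₀).not_gt h.1)]
      simp
    rcases le_or_gt t c with htc | htc
    · have hc : 0 < c := ht.trans_le htc
      have : Prod.mk t ⁻¹' T = {y | ‖y‖ ^ 2 < (1 - c ^ 2) / c ^ 2 * t ^ 2} := by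
        ext y
        simp only [hT, Set.mem_preimage, Set.mem_ofPred_eq, ht, true_and]
        rw [div_mul_eq_mul_div, lt_div_iff₀ (by positivity)]
        constructor
        · rintro ⟨-, h⟩
          linarith
        · intro h
          have h2 : c ^ 2 * (t ^ 2 + ‖y‖ ^ 2) < t ^ 2 := by linarith
          refine ⟨?_, h2⟩
          have h3 : t ^ 2 ≤ c ^ 2 := by gcongr
          by_contra! h4
          have := mul_le_mul_of_nonneg_left h4 (sq_nonneg c)
          linarith
      rw [this, volume_setOf_norm_sq_lt, Set.indicator_of_mem (Set.mem_Ioc.2 ⟨ht, htc⟩),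
        Set.indicator_of_notMem (fun h => htc.not_gt h.1), add_zero]
    · have : Prod.mk t ⁻¹' T = {y | ‖y‖ ^ 2 < 1 - t ^ 2} := by
        ext y
        simp only [hT, Set.mem_preimage, Set.mem_ofPred_eq, ht, true_and]
        constructor
        · rintro ⟨h, -⟩
          linarith
        · intro h
          have h3 : c ^ 2 < t ^ 2 := by gcongr
          refine ⟨by linarith, ?_⟩
          have := mul_le_mul_of_nonneg_left (by linarith : t ^ 2 + ‖y‖ ^ 2 ≤ 1) (sq_nonneg c)
          linarith
      rw [this, volume_setOf_norm_sq_lt, Set.indicator_of_notMem (fun h => htc.not_ge h.2),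
        zero_add]
      rcases le_or_gt t 1 with ht1 | ht1
      · rw [Set.indicator_of_mem (Set.mem_Ioc.2 ⟨htc, ht1⟩)]
      · rw [Set.indicator_of_notMem (fun h => ht1.not_ge h.2), ENNReal.ofReal_of_nonpos]
        have : 1 - t ^ 2 ≤ 0 := by nlinarith
        exact mul_nonpos_of_nonneg_of_nonpos pi_pos.le this
  have hc2 : 0 ≤ 1 - c ^ 2 := by nlinarith
  rw [hpre, measurePreserving_coordSplit.measure_preimage hTm.nullMeasurableSet,
    Measure.volume_eq_prod, Measure.prod_apply hTm]
  simp_rw [hslice]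
  rw [lintegral_add_left ((by fun_prop : Measurable fun t : ℝ =>
      ENNReal.ofReal (π * ((1 - c ^ 2) / c ^ 2 * t ^ 2))).indicator measurableSet_Ioc),
    lintegral_indicator measurableSet_Ioc, lintegral_indicator measurableSet_Ioc,
    ← ofReal_integral_eq_lintegral_ofReal
      ((by fun_prop : Continuous fun t : ℝ => π * ((1 - c ^ 2) / c ^ 2 * t ^ 2)).integrableOn_Ioc)
      (.of_forall fun t => by positivity),
    ← ofReal_integral_eq_lintegral_ofReal
      ((by fun_prop : Continuous fun t : ℝ => π * (1 - t ^ 2)).integrableOn_Ioc)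
      ((ae_restrict_mem measurableSet_Ioc).mono fun t ht => ?_),
    ← intervalIntegral.integral_of_le hc₀, ← intervalIntegral.integral_of_le hc₁,
    ← ENNReal.ofReal_add]
  · congr 1
    rw [intervalIntegral.integral_const_mul, intervalIntegral.integral_const_mul,
      intervalIntegral.integral_const_mul, intervalIntegral.integral_sub (by simp) (by simp)]
    rcases hc₀.eq_or_lt with rfl | hc
    · norm_num
      ring
    · simp
      field_simp
      ring
  · exact intervalIntegral.integral_nonneg hc₀ fun t _ => by positivity
  · refine intervalIntegral.integral_nonneg hc₁ fun t ht => ?_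
    have : 0 ≤ 1 - t ^ 2 := by nlinarith [ht.1, ht.2]
    positivity
  · have : 0 ≤ 1 - t ^ 2 := by nlinarith [ht.1, ht.2]
    simp only [Pi.zero_apply]
    positivity

open scoped RealInnerProductSpace

/-- The volume of the part of the unit ball of `ℝ³` within a cone about an arbitrary axis. -/
lemma volume_sector {v : EuclideanSpace ℝ (Fin 3)} (hv : ‖v‖ = 1) {c : ℝ} (hc₀ : 0 ≤ c)
    (hc₁ : c ≤ 1) :
    volume {x : EuclideanSpace ℝ (Fin 3) | ‖x‖ < 1 ∧ c * ‖x‖ < ⟪x, v⟫} =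
      ENNReal.ofReal (2 * π / 3 * (1 - c)) := by
  set e : EuclideanSpace ℝ (Fin 3) := EuclideanSpace.single 0 1 with he
  set R := (ℝ ∙ (v - e))ᗮ.reflection with hR
  have hRv : R v = e := Submodule.reflection_sub (by simp [hv, he])
  have hinner (x : EuclideanSpace ℝ (Fin 3)) : (R x) 0 = ⟪x, v⟫ := by
    rw [← R.inner_map_map x v, hRv, he, EuclideanSpace.inner_single_right]
    simp
  have hm : MeasurableSet {x : EuclideanSpace ℝ (Fin 3) | ‖x‖ < 1 ∧ c * ‖x‖ < x 0} := by
    refine IsOpen.measurableSet ?_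
    refine (isOpen_lt ?_ ?_).and (isOpen_lt ?_ ?_) <;> fun_prop
  rw [← volume_sector_axis hc₀ hc₁, ← R.measurePreserving.measure_preimage hm.nullMeasurableSet]
  congr 1
  ext x
  simp [hinner]

namespace SO3

lemma act_mul_s7 (g h : ↥SO3) (x : EuclideanSpace ℝ (Fin 3)) : act (g * h) x = act g (act h x) := by
  ext i
  simp [act]

lemma inner_act_act_s7 (g : ↥SO3) (x y : EuclideanSpace ℝ (Fin 3)) :
    ⟪act g x, act g y⟫ = ⟪x, y⟫ := by
  have hg := (Matrix.mem_orthogonalGroup_iff' (Fin 3) ℝ).1 (g : Matrix.orthogonalGroup (Fin 3) ℝ).2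
  simp only [act, EuclideanSpace.inner_eq_star_dotProduct, Matrix.ofLp_toLpLin, star_trivial,
    Matrix.toLin'_apply]
  rw [Matrix.dotProduct_mulVec, ← Matrix.mulVec_transpose, Matrix.mulVec_mulVec, hg,
    Matrix.one_mulVec]

lemma norm_act_s7 (g : ↥SO3) (x : EuclideanSpace ℝ (Fin 3)) : ‖act g x‖ = ‖x‖ := by
  rw [norm_eq_sqrt_real_inner, inner_act_act_s7, ← norm_eq_sqrt_real_inner]

lemma angle_act_act_s7 (g : ↥SO3) (x y : EuclideanSpace ℝ (Fin 3)) :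
    angle (act g x) (act g y) = angle x y := by
  simp [angle, inner_act_act_s7, norm_act_s7]

lemma continuous_act (x : EuclideanSpace ℝ (Fin 3)) : Continuous fun g : ↥SO3 => act g x := by
  have h : Continuous fun g : ↥SO3 =>
      ((g : Matrix.orthogonalGroup (Fin 3) ℝ) : Matrix (Fin 3) (Fin 3) ℝ) :=
    continuous_subtype_val.comp continuous_subtype_val
  exact (PiLp.continuous_toLp 2 _).comp (h.matrix_mulVec continuous_const)

/-- The half-turn about the line spanned by a unit vector. -/
lemma exists_halfTurn {w : EuclideanSpace ℝ (Fin 3)} (hw : ‖w‖ = 1) :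
    ∃ g : ↥SO3, ∀ x, act g x = (2 * ⟪w, x⟫) • w - x := by
  have hw' : w 0 ^ 2 + w 1 ^ 2 + w 2 ^ 2 = 1 := by
    have := EuclideanSpace.norm_sq_eq w
    simpa [hw, Fin.sum_univ_three] using this.symm
  set M : Matrix (Fin 3) (Fin 3) ℝ := (2 : ℝ) • Matrix.vecMulVec w w - 1 with hM
  have hdet : M.det = 1 := by
    simp [hM, Matrix.det_fin_three, Matrix.vecMulVec_apply]
    linear_combination 2 * hw'
  have horth : M ∈ Matrix.orthogonalGroup (Fin 3) ℝ := by
    rw [Matrix.mem_orthogonalGroup_iff]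
    have hdot : w.ofLp ⬝ᵥ w.ofLp = 1 := by
      rw [← hw', dotProduct, Fin.sum_univ_three]
      ring
    have hstar : M.transpose = M := by
      ext i j
      simp [hM, Matrix.vecMulVec_apply, Matrix.one_apply, mul_comm, eq_comm]
    rw [hstar, hM, sub_mul, mul_sub, Matrix.smul_mul, Matrix.mul_smul,
      Matrix.vecMulVec_mul_vecMulVec, hdot]
    simp only [one_smul, mul_one, one_mul]
    module
  refine ⟨⟨⟨M, horth⟩, hdet⟩, fun x => ?_⟩
  ext i
  have hx : ⟪w, x⟫ = w 0 * x 0 + w 1 * x 1 + w 2 * x 2 := by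
    simp [PiLp.inner_apply, Fin.sum_univ_three, mul_comm]
  rw [hx]
  simp [act, hM, Matrix.vecMulVec_mulVec, dotProduct, Fin.sum_univ_three]
  ring

lemma exists_act_eq_s7 {u v : EuclideanSpace ℝ (Fin 3)} (hu : ‖u‖ = 1) (hv : ‖v‖ = 1) :
    ∃ g : ↥SO3, act g u = v := by
  by_cases h : u + v = 0
  · obtain ⟨w, hw, hwu⟩ : ∃ w : EuclideanSpace ℝ (Fin 3), ‖w‖ = 1 ∧ ⟪w, u⟫ = 0 := by
      have hne : (ℝ ∙ u)ᗮ ≠ ⊥ := by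
        rw [Ne, Submodule.orthogonal_eq_bot_iff]
        intro htop
        have h1 := finrank_span_le_card (R := ℝ) ({u} : Set (EuclideanSpace ℝ (Fin 3)))
        rw [htop] at h1
        simp at h1
      obtain ⟨y, hy, hy0⟩ := Submodule.exists_mem_ne_zero_of_ne_bot hne
      refine ⟨‖y‖⁻¹ • y, norm_smul_inv_norm (𝕜 := ℝ) hy0, ?_⟩
      rw [real_inner_smul_left, real_inner_comm,
        Submodule.mem_orthogonal_singleton_iff_inner_right.1 hy, mul_zero]
    obtain ⟨g, hg⟩ := exists_halfTurn hw
    refine ⟨g, ?_⟩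
    rw [hg, hwu, mul_zero, zero_smul, zero_sub, neg_eq_iff_add_eq_zero, h]
  · have h0 : ‖u + v‖ ≠ 0 := norm_ne_zero_iff.2 h
    obtain ⟨g, hg⟩ := exists_halfTurn (w := ‖u + v‖⁻¹ • (u + v)) (norm_smul_inv_norm (𝕜 := ℝ) h)
    refine ⟨g, ?_⟩
    have h1 : ‖u + v‖ ^ 2 = 2 * ⟪u + v, u⟫ := by
      rw [norm_add_sq_real, inner_add_left, real_inner_self_eq_norm_sq, hu, hv, real_inner_comm]
      ring
    rw [hg, real_inner_smul_left, smul_smul]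
    have : 2 * (‖u + v‖⁻¹ * ⟪u + v, u⟫) * ‖u + v‖⁻¹ = 1 := by
      field_simp
      linarith
    rw [this, one_smul, add_sub_cancel_left]

lemma measure_cap_translate (μ : Measure ↥SO3) [μ.IsHaarMeasure] {u v : EuclideanSpace ℝ (Fin 3)}
    (hu : ‖u‖ = 1) (hv : ‖v‖ = 1) (c : ℝ) :
    μ {g | c < ⟪v, act g u⟫} = μ {g | c < ⟪u, act g u⟫} := by
  obtain ⟨h, hh⟩ := exists_act_eq_s7 hv hu
  rw [← measure_preimage_mul μ h {g | c < ⟪u, act g u⟫}]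
  congr 1
  ext g
  simp only [Set.mem_ofPred_eq, Set.mem_preimage, act_mul_s7]
  rw [← inner_act_act_s7 h v, hh]

lemma measure_cap_of_nonneg (μ : Measure ↥SO3) [μ.IsHaarMeasure] [IsProbabilityMeasure μ]
    {u : EuclideanSpace ℝ (Fin 3)} (hu : ‖u‖ = 1) {c : ℝ} (hc₀ : 0 ≤ c) (hc₁ : c ≤ 1) :
    μ {g | c < ⟪u, act g u⟫} = ENNReal.ofReal ((1 - c) / 2) := by
  set S : Set (↥SO3 × EuclideanSpace ℝ (Fin 3)) :=
    {p | ‖p.2‖ < 1 ∧ c * ‖p.2‖ < ⟪p.2, act p.1 u⟫} with hS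
  have hSm : MeasurableSet S := by
    refine IsOpen.measurableSet ?_
    have hact : Continuous fun p : ↥SO3 × EuclideanSpace ℝ (Fin 3) => act p.1 u :=
      (continuous_act u).comp continuous_fst
    exact (isOpen_lt continuous_snd.norm continuous_const).and
      (isOpen_lt (continuous_const.mul continuous_snd.norm) (continuous_snd.inner hact))
  have h1 : (μ.prod volume) S = ENNReal.ofReal (2 * π / 3 * (1 - c)) := by
    rw [Measure.prod_apply hSm]
    have (g : ↥SO3) : volume (Prod.mk g ⁻¹' S) = ENNReal.ofReal (2 * π / 3 * (1 - c)) := by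
      rw [← volume_sector (v := act g u) (by rw [norm_act_s7, hu]) hc₀ hc₁]
      congr 1
    simp [this]
  have h2 : (μ.prod volume) S = μ {g | c < ⟪u, act g u⟫} * ENNReal.ofReal (π * 4 / 3) := by
    rw [Measure.prod_apply_symm hSm]
    have (x : EuclideanSpace ℝ (Fin 3)) (hx : x ≠ 0) : μ ((fun g => (g, x)) ⁻¹' S) =
        (Metric.ball (0 : EuclideanSpace ℝ (Fin 3)) 1).indicator
          (fun _ => μ {g | c < ⟪u, act g u⟫}) x := by
      by_cases hx1 : ‖x‖ < 1
      · rw [Set.indicator_of_mem (by simpa using hx1),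
          ← measure_cap_translate μ hu (v := ‖x‖⁻¹ • x) (norm_smul_inv_norm (𝕜 := ℝ) hx)]
        congr 1
        ext g
        have h0 : 0 < ‖x‖ := norm_pos_iff.2 hx
        simp only [hS, Set.mem_preimage, Set.mem_ofPred_eq, hx1, true_and, real_inner_smul_left]
        rw [inv_mul_eq_div, lt_div_iff₀ h0]
      · rw [Set.indicator_of_notMem (by simpa using hx1)]
        simp [hS, hx1]
    have hae : ∀ᵐ x : EuclideanSpace ℝ (Fin 3), x ≠ 0 := Measure.ae_ne volume 0
    rw [lintegral_congr_ae (hae.mono this), lintegral_indicator measurableSet_ball]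
    simp
  have h3 := congrArg ENNReal.toReal (h2.symm.trans h1)
  rw [ENNReal.toReal_mul, ENNReal.toReal_ofReal (by positivity), ENNReal.toReal_ofReal
    (mul_nonneg (by positivity) (by linarith))] at h3
  rw [← ENNReal.ofReal_toReal (measure_ne_top μ _)]
  congr 1
  field_simp at h3
  linarith

/-- Archimedes: for `g` distributed according to Haar measure, `⟪u, g u⟫` is uniformly distributed
on `[-1, 1]`. -/
lemma measure_cap (μ : Measure ↥SO3) [μ.IsHaarMeasure] [IsProbabilityMeasure μ]
    {u : EuclideanSpace ℝ (Fin 3)} (hu : ‖u‖ = 1) {c : ℝ} (hc₀ : -1 ≤ c) (hc₁ : c ≤ 1) :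
    μ {g | c < ⟪u, act g u⟫} = ENNReal.ofReal ((1 - c) / 2) := by
  rcases le_or_gt 0 c with hc | hc
  · exact measure_cap_of_nonneg μ hu hc hc₁
  have hreal {b : ℝ} (hb₀ : 0 ≤ b) (hb₁ : b ≤ 1) : μ.real {g | b < ⟪u, act g u⟫} = (1 - b) / 2 := by
    rw [measureReal_def, measure_cap_of_nonneg μ hu hb₀ hb₁, ENNReal.toReal_ofReal (by linarith)]
  have hcompl : μ.real {g | -c ≤ ⟪u, act g u⟫} = 1 - μ.real {g | c < ⟪u, act g u⟫} := by
    have hneg : μ {g | c < ⟪-u, act g u⟫} = μ {g | c < ⟪u, act g u⟫} :=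
      measure_cap_translate μ hu (by rw [norm_neg, hu]) c
    have hm : MeasurableSet {g | c < ⟪-u, act g u⟫} :=
      (isOpen_lt continuous_const (continuous_const.inner (continuous_act u))).measurableSet
    rw [measureReal_def (s := {g | c < ⟪u, act g u⟫}), ← hneg, ← measureReal_def,
      ← probReal_compl_eq_one_sub hm]
    congr 1
    ext g
    simp [neg_le]
  have hle : μ.real {g | -c ≤ ⟪u, act g u⟫} ≤ (1 - -c) / 2 := by
    refine le_of_forall_pos_le_add fun ε hε => ?_
    set b := max 0 (-c - ε) with hb
    have hbc : b < -c := max_lt (by linarith) (by linarith)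
    calc _ ≤ μ.real {g | b < ⟪u, act g u⟫} := measureReal_mono fun g hg => hbc.trans_le hg
      _ = (1 - b) / 2 := hreal (le_max_left _ _) (by linarith)
      _ ≤ _ := by linarith [le_max_right 0 (-c - ε)]
  have hge : (1 - -c) / 2 ≤ μ.real {g | -c ≤ ⟪u, act g u⟫} := by
    rw [← hreal (b := -c) (by linarith) (by linarith)]
    exact measureReal_mono fun g (hg : -c < ⟪u, act g u⟫) => hg.le
  rw [← ENNReal.ofReal_toReal (measure_ne_top μ _), ← measureReal_def]
  congr 1
  linarith

/-- The midpoint direction of two unit vectors halves the angle between them. -/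
lemma _root_.exists_angle_eq_half {u v : EuclideanSpace ℝ (Fin 3)} (hu : ‖u‖ = 1) (hv : ‖v‖ = 1)
    (h : angle u v < π) :
    ∃ w : EuclideanSpace ℝ (Fin 3), ‖w‖ = 1 ∧ angle u w = angle u v / 2 ∧
      angle w v = angle u v / 2 := by
  set φ := angle u v with hφ
  have hφ0 : 0 ≤ φ := angle_nonneg u v
  have hcos : ⟪u, v⟫ = cos φ := by rw [hφ, cos_angle, hu, hv]; simp
  have hpos : 0 < cos (φ / 2) := cos_pos_of_mem_Ioo ⟨by linarith [pi_pos], by linarith⟩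
  have hc : cos φ = 2 * cos (φ / 2) ^ 2 - 1 := by rw [← cos_two_mul]; congr 1; ring
  have hn : ‖u + v‖ = 2 * cos (φ / 2) := by
    rw [← sq_eq_sq₀ (norm_nonneg _) (by positivity), norm_add_sq_real, hu, hv, hcos, hc]
    ring
  have hw : ‖(2 * cos (φ / 2))⁻¹ • (u + v)‖ = 1 := by
    rw [norm_smul, hn, norm_of_nonneg (by positivity), inv_mul_cancel₀ (by positivity)]
  have key {a b : EuclideanSpace ℝ (Fin 3)} (hab : ⟪a, b⟫ / (‖a‖ * ‖b‖) = cos (φ / 2)) :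
      angle a b = φ / 2 := by
    rw [angle, hab, arccos_cos (by linarith) (by linarith)]
  refine ⟨_, hw, key ?_, key ?_⟩
  · rw [hw, hu, real_inner_smul_right, inner_add_right, real_inner_self_eq_norm_sq, hu, hcos, hc]
    field_simp
    ring
  · rw [hw, hv, real_inner_smul_left, inner_add_left, real_inner_self_eq_norm_sq, hv, hcos, hc]
    field_simp
    ring

lemma setOf_angle_lt_mul_self {u : EuclideanSpace ℝ (Fin 3)} (hu : ‖u‖ = 1) {θ : ℝ}
    (hθ : θ ≤ π / 2) :
    {g : ↥SO3 | angle u (act g u) < θ} * {g : ↥SO3 | angle u (act g u) < θ} =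
      {g : ↥SO3 | angle u (act g u) < 2 * θ} := by
  ext g
  simp only [Set.mem_mul, Set.mem_ofPred_eq]
  constructor
  · rintro ⟨a, ha, b, hb, rfl⟩
    have := angle_le_angle_add_angle u (act a u) (act (a * b) u)
    rw [act_mul_s7, angle_act_act_s7] at this
    rw [act_mul_s7]
    linarith
  · intro hg
    obtain ⟨w, hw, h1, h2⟩ := exists_angle_eq_half hu (by rw [norm_act_s7, hu] : ‖act g u‖ = 1)
      (by linarith)
    obtain ⟨a, rfl⟩ := exists_act_eq_s7 hu hw
    refine ⟨a, by linarith, a⁻¹ * g, ?_, mul_inv_cancel_left a g⟩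
    rw [← angle_act_act_s7 a, ← act_mul_s7, mul_inv_cancel_left]
    linarith

lemma measure_setOf_angle_lt (μ : Measure ↥SO3) [μ.IsHaarMeasure] [IsProbabilityMeasure μ]
    {u : EuclideanSpace ℝ (Fin 3)} (hu : ‖u‖ = 1) {θ : ℝ} (hθ₀ : 0 ≤ θ) (hθ₁ : θ ≤ π) :
    μ {g | angle u (act g u) < θ} = ENNReal.ofReal ((1 - cos θ) / 2) := by
  rw [← measure_cap μ hu (neg_one_le_cos θ) (cos_le_one θ)]
  congr 1
  ext g
  have : ⟪u, act g u⟫ = cos (angle u (act g u)) := by rw [cos_angle, norm_act_s7, hu]; simp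
  simp only [Set.mem_ofPred_eq, this]
  exact (strictAntiOn_cos.lt_iff_gt ⟨hθ₀, hθ₁⟩ ⟨angle_nonneg _ _, angle_le_pi _ _⟩).symm

end SO3

/-- For A = {g ∈ SO(3,ℝ) : ∠(u, g·u) < θ} with θ ∈ (0, π/2], one has
μ(A·A) = 4·μ(A)·(1 − μ(A)); in particular μ(A·A) < 4·μ(A). -/
theorem SO3_cap_doubling (μ : Measure ↥SO3) [μ.IsHaarMeasure] [IsProbabilityMeasure μ]
    (u : EuclideanSpace ℝ (Fin 3)) (hu : ‖u‖ = 1) (θ : ℝ) (hθ₀ : 0 < θ) (hθ₁ : θ ≤ π / 2)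
    (A : Set ↥SO3) (hA : A = {g : ↥SO3 | angle u (SO3.act g u) < θ}) :
    μ (A * A) = 4 * μ A * (1 - μ A) ∧ μ (A * A) < 4 * μ A := by
  have hcos : cos θ < 1 := by
    simpa using cos_lt_cos_of_nonneg_of_le_pi le_rfl (by linarith [pi_pos]) hθ₀
  have hcos₀ : 0 ≤ cos θ := cos_nonneg_of_mem_Icc ⟨by linarith [pi_pos], hθ₁⟩
  have hμA : μ A = ENNReal.ofReal ((1 - cos θ) / 2) := by
    rw [hA, SO3.measure_setOf_angle_lt μ hu hθ₀.le (by linarith [pi_pos])]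
  have hμAA : μ (A * A) = ENNReal.ofReal (1 - cos θ ^ 2) := by
    rw [hA, SO3.setOf_angle_lt_mul_self hu hθ₁,
      SO3.measure_setOf_angle_lt μ hu (by linarith) (by linarith), cos_two_mul]
    congr 1
    ring
  have h4 : 4 * ENNReal.ofReal ((1 - cos θ) / 2) = ENNReal.ofReal (2 * (1 - cos θ)) := by
    rw [← ENNReal.ofReal_ofNat 4, ← ENNReal.ofReal_mul (by norm_num)]
    congr 1
    ring
  rw [hμA, hμAA, h4]
  constructor
  · rw [← ENNReal.ofReal_one, ← ENNReal.ofReal_sub _ (by linarith),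
      ← ENNReal.ofReal_mul (by linarith)]
    congr 1
    ring
  · rw [ENNReal.ofReal_lt_ofReal_iff (by linarith)]
    nlinarith
end

section
/- Let SL(2,ℝ) act on the hyperbolic upper half-plane ℍ by fractional linear transformations, and for r > 0 set A_r = {g ∈ SL(2,ℝ) : d(g·i, i) < r}, where d is the hyperbolic distance on ℍ and i ∈ ℍ is the imaginary unit. Then there exists a (left and right invariant) Haar measure μ on SL(2,ℝ) such that for every r > 0, μ(A_r · A_r) ≤ 4·μ(A_r)·(1 + μ(A_r)). -/
open MeasureTheory
open scoped Pointwise MatrixGroups UpperHalfPlane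

instance : TopologicalSpace SL(2, ℝ) :=
  inferInstanceAs (TopologicalSpace {A : Matrix (Fin 2) (Fin 2) ℝ // A.det = 1})
noncomputable instance : MeasurableSpace SL(2, ℝ) := borel _
instance : BorelSpace SL(2, ℝ) := ⟨rfl⟩

namespace SL2Haar

instance : IsTopologicalGroup SL(2, ℝ) := Matrix.SpecialLinearGroup.topologicalGroup

theorem continuous_entry (i j : Fin 2) : Continuous fun g : SL(2, ℝ) => g i j :=
  (continuous_apply j).comp ((continuous_apply i).comp continuous_subtype_val)

/-- The sum of the squares of the entries. -/
def normSq (g : SL(2, ℝ)) : ℝ := g 0 0 ^ 2 + g 0 1 ^ 2 + g 1 0 ^ 2 + g 1 1 ^ 2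

theorem continuous_normSq : Continuous normSq := by
  have h := continuous_entry
  exact ((((h 0 0).pow 2).add ((h 0 1).pow 2)).add ((h 1 0).pow 2)).add ((h 1 1).pow 2)

theorem cosh_dist_smul_I (g : SL(2, ℝ)) :
    Real.cosh (dist (g • UpperHalfPlane.I) UpperHalfPlane.I) = normSq g / 2 := by
  have hdet : g 0 0 * g 1 1 - g 0 1 * g 1 0 = 1 := by
    have := g.det_coe
    rwa [Matrix.det_fin_two] at this
  have hD : 0 < g 1 0 ^ 2 + g 1 1 ^ 2 := by
    by_contra! h
    have h0 : g 1 0 = 0 := by nlinarith [sq_nonneg (g 1 0), sq_nonneg (g 1 1)]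
    have h1 : g 1 1 = 0 := by nlinarith [sq_nonneg (g 1 0), sq_nonneg (g 1 1)]
    simp [h0, h1] at hdet
  have hre : (g • UpperHalfPlane.I).re =
      (g 0 0 * g 1 0 + g 0 1 * g 1 1) / (g 1 0 ^ 2 + g 1 1 ^ 2) := by
    rw [UpperHalfPlane.specialLinearGroup_apply]
    simp [UpperHalfPlane.re, Complex.div_re, Complex.normSq_apply]
    ring
  have him : (g • UpperHalfPlane.I).im = 1 / (g 1 0 ^ 2 + g 1 1 ^ 2) := by
    rw [UpperHalfPlane.specialLinearGroup_apply]
    simp [UpperHalfPlane.im, Complex.div_im, Complex.normSq_apply]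
    simp only [← sq, add_comm (g 1 1 ^ 2)]
    field_simp
    linear_combination hdet
  rw [UpperHalfPlane.cosh_dist', hre, him, normSq]
  simp only [UpperHalfPlane.I_re, UpperHalfPlane.I_im]
  field_simp
  linear_combination (-(g 0 0 * g 1 1 - g 0 1 * g 1 0) - 1) * hdet

theorem setOf_dist_smul_I_lt {r : ℝ} (hr : 0 ≤ r) :
    {g : SL(2, ℝ) | dist (g • UpperHalfPlane.I) UpperHalfPlane.I < r} =
      {g | normSq g < 2 * Real.cosh r} := by
  ext g
  rw [Set.mem_ofPred_eq, Set.mem_ofPred_eq, ← abs_of_nonneg hr,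
    ← abs_of_nonneg (dist_nonneg (x := g • UpperHalfPlane.I) (y := UpperHalfPlane.I)),
    ← Real.cosh_lt_cosh, cosh_dist_smul_I, Real.cosh_abs, div_lt_iff₀' two_pos]

theorem setOf_dist_smul_I_lt_mul_self_subset (r : ℝ) :
    {g : SL(2, ℝ) | dist (g • UpperHalfPlane.I) UpperHalfPlane.I < r} *
        {g : SL(2, ℝ) | dist (g • UpperHalfPlane.I) UpperHalfPlane.I < r} ⊆
      {g : SL(2, ℝ) | dist (g • UpperHalfPlane.I) UpperHalfPlane.I < 2 * r} := by
  rintro _ ⟨g, hg, h, hh, rfl⟩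
  simp only [Set.mem_ofPred_eq] at hg hh ⊢
  calc dist ((g * h) • UpperHalfPlane.I) UpperHalfPlane.I
      ≤ dist (g • h • UpperHalfPlane.I) (g • UpperHalfPlane.I) +
          dist (g • UpperHalfPlane.I) UpperHalfPlane.I := by
        rw [mul_smul]; exact dist_triangle _ _ _
    _ < 2 * r := by rw [dist_smul]; linarith

/-- The coordinates on `2 × 2` real matrices given by the decomposition of a real-linear
endomorphism of `ℂ` into complex-linear and antilinear parts. -/
noncomputable def coordMatrix : (ℂ × ℂ) ≃ₗ[ℝ] Matrix (Fin 2) (Fin 2) ℝ where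
  toFun p := !![p.1.re + p.2.re, p.2.im - p.1.im; p.2.im + p.1.im, p.1.re - p.2.re]
  invFun m := (⟨(m 0 0 + m 1 1) / 2, (m 1 0 - m 0 1) / 2⟩,
    ⟨(m 0 0 - m 1 1) / 2, (m 1 0 + m 0 1) / 2⟩)
  map_add' p q := by
    ext i j
    fin_cases i <;> fin_cases j <;> simp <;> ring
  map_smul' c p := by
    ext i j
    fin_cases i <;> fin_cases j <;> simp [mul_add, mul_sub]
  left_inv p := by
    ext <;> simp
  right_inv m := by
    ext i j
    fin_cases i <;> fin_cases j <;> simp <;> ring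

theorem coordMatrix_apply (p : ℂ × ℂ) : coordMatrix p =
    !![p.1.re + p.2.re, p.2.im - p.1.im; p.2.im + p.1.im, p.1.re - p.2.re] := rfl

theorem continuous_coordMatrix : Continuous coordMatrix := by
  refine continuous_pi fun i => continuous_pi fun j => ?_
  fin_cases i <;> fin_cases j <;> simp [coordMatrix_apply] <;> fun_prop

/-- The determinant in the coordinates `coordMatrix`. -/
noncomputable def detForm (p : ℂ × ℂ) : ℝ := ‖p.1‖ ^ 2 - ‖p.2‖ ^ 2

theorem det_coordMatrix (p : ℂ × ℂ) : (coordMatrix p).det = detForm p := by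
  simp [coordMatrix_apply, Matrix.det_fin_two, detForm, Complex.sq_norm, Complex.normSq_apply]
  ring

theorem continuous_detForm : Continuous detForm := by
  unfold detForm; fun_prop

/-- The radial projection of matrices of positive determinant to `SL(2, ℝ)`. -/
noncomputable def toSL (p : ℂ × ℂ) : SL(2, ℝ) :=
  if h : 0 < detForm p then
    ⟨(√(detForm p))⁻¹ • coordMatrix p, by
      rw [Matrix.det_smul, det_coordMatrix, Fintype.card_fin, inv_pow, Real.sq_sqrt h.le,
        inv_mul_cancel₀ h.ne']⟩
  else 1

theorem coe_toSL {p : ℂ × ℂ} (h : 0 < detForm p) :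
    (toSL p : Matrix (Fin 2) (Fin 2) ℝ) = (√(detForm p))⁻¹ • coordMatrix p := by
  exact congrArg Subtype.val (dif_pos h)

theorem isOpen_detForm_pos : IsOpen {p | 0 < detForm p} :=
  isOpen_lt continuous_const continuous_detForm

theorem continuousOn_toSL : ContinuousOn toSL {p | 0 < detForm p} := by
  rw [continuousOn_iff_continuous_domRestrict]
  refine continuous_induced_rng.mpr ?_
  refine Continuous.congr (f := fun p : {p | 0 < detForm p} =>
    (√(detForm p.1))⁻¹ • coordMatrix p.1) ?_ fun p => (coe_toSL p.2).symm
  refine Continuous.smul (Continuous.inv₀ ?_ fun p => (Real.sqrt_pos.mpr p.2).ne') ?_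
  · exact (continuous_detForm.comp continuous_subtype_val).sqrt
  · exact continuous_coordMatrix.comp continuous_subtype_val

theorem measurable_toSL : Measurable toSL := by
  refine measurable_of_isOpen fun U hU => ?_
  have h : toSL ⁻¹' U = ({p | 0 < detForm p} ∩ toSL ⁻¹' U) ∪
      ({p | 0 < detForm p}ᶜ ∩ {_p | (1 : SL(2, ℝ)) ∈ U}) := by
    ext p
    by_cases hp : 0 < detForm p
    · simp [hp]
    · simp [hp, toSL]
  rw [h]
  exact (continuousOn_toSL.isOpen_inter_preimage isOpen_detForm_pos hU).measurableSet.union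
    (isOpen_detForm_pos.measurableSet.compl.inter (MeasurableSet.const _))

/-- Matrices of determinant in `(0, 1]`. -/
def cone : Set (ℂ × ℂ) := {p | 0 < detForm p ∧ detForm p ≤ 1}

theorem measurableSet_cone : MeasurableSet cone :=
  isOpen_detForm_pos.measurableSet.inter
    (isClosed_le continuous_detForm continuous_const).measurableSet

/-- The cone measure on `SL(2, ℝ)`. -/
noncomputable def coneMeasure : Measure SL(2, ℝ) := (volume.restrict cone).map toSL

theorem coneMeasure_apply {s : Set SL(2, ℝ)} (hs : MeasurableSet s) :
    coneMeasure s = volume (toSL ⁻¹' s ∩ cone) := by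
  rw [coneMeasure, Measure.map_apply measurable_toSL hs,
    Measure.restrict_apply (measurable_toSL hs)]

theorem map_coneMeasure {φ : SL(2, ℝ) → SL(2, ℝ)} (hφ : Measurable φ)
    {f : (ℂ × ℂ) →ₗ[ℝ] (ℂ × ℂ)} (hf : LinearMap.det f = 1)
    (hdet : ∀ p, detForm (f p) = detForm p)
    (h : ∀ p, 0 < detForm p → toSL (f p) = φ (toSL p)) :
    coneMeasure.map φ = coneMeasure := by
  have hfm : Measurable f := f.continuous_of_finiteDimensional.measurable
  have hvol : (volume : Measure (ℂ × ℂ)).map f = volume := by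
    have : (volume : Measure (ℂ × ℂ)).IsAddHaarMeasure :=
      inferInstanceAs ((volume : Measure ℂ).prod volume).IsAddHaarMeasure
    rw [Measure.map_linearMap_addHaar_eq_smul_addHaar volume (by simp [hf])]
    simp [hf]
  ext s hs
  rw [Measure.map_apply hφ hs, coneMeasure_apply (hφ hs), coneMeasure_apply hs]
  conv_rhs => rw [← hvol]
  rw [Measure.map_apply hfm ((measurable_toSL hs).inter measurableSet_cone)]
  congr 1
  ext p
  simp only [cone, Set.mem_inter_iff, Set.mem_preimage, Set.mem_ofPred_eq, hdet]
  refine and_congr_left fun hp => ?_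
  rw [h p hp.1]

theorem det_matrix_mulRight (a : Matrix (Fin 2) (Fin 2) ℝ) :
    LinearMap.det (LinearMap.mulRight ℝ a) = a.det ^ 2 := by
  have h := LinearMap.det_pi (ι := Fin 2) fun _ => Matrix.toLin' a.transpose
  simp only [LinearMap.det_toLin', Matrix.det_transpose, Finset.prod_const, Finset.card_univ,
    Fintype.card_fin] at h
  rw [← h]
  congr 1
  ext m i j
  change (m * a) i j = (a.transpose.mulVec (m i)) j
  simp [Matrix.mul_apply, Matrix.mulVec, dotProduct, mul_comm]

theorem det_matrix_mulLeft (a : Matrix (Fin 2) (Fin 2) ℝ) :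
    LinearMap.det (LinearMap.mulLeft ℝ a) = a.det ^ 2 := by
  rw [← a.det_transpose, ← det_matrix_mulRight,
    ← LinearMap.det_conj (LinearMap.mulRight ℝ a.transpose)
      (Matrix.transposeLinearEquiv (Fin 2) (Fin 2) ℝ ℝ)]
  congr 1
  ext1 m
  simp

/-- A linear endomorphism of matrices in the coordinates `coordMatrix`. -/
noncomputable def conjCoord (f : Matrix (Fin 2) (Fin 2) ℝ →ₗ[ℝ] Matrix (Fin 2) (Fin 2) ℝ) :
    (ℂ × ℂ) →ₗ[ℝ] (ℂ × ℂ) :=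
  coordMatrix.symm.toLinearMap ∘ₗ f ∘ₗ coordMatrix.symm.symm.toLinearMap

theorem coordMatrix_conjCoord (f : Matrix (Fin 2) (Fin 2) ℝ →ₗ[ℝ] Matrix (Fin 2) (Fin 2) ℝ)
    (p : ℂ × ℂ) : coordMatrix (conjCoord f p) = f (coordMatrix p) := by
  simp [conjCoord]

theorem map_coneMeasure_of_linear {φ : SL(2, ℝ) → SL(2, ℝ)} (hφ : Measurable φ)
    {f : Matrix (Fin 2) (Fin 2) ℝ →ₗ[ℝ] Matrix (Fin 2) (Fin 2) ℝ} (hf : LinearMap.det f = 1)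
    (hdet : ∀ m, (f m).det = m.det)
    (h : ∀ g : SL(2, ℝ), (φ g : Matrix (Fin 2) (Fin 2) ℝ) = f g) :
    coneMeasure.map φ = coneMeasure := by
  have hd (p) : detForm (conjCoord f p) = detForm p := by
    rw [← det_coordMatrix, coordMatrix_conjCoord, hdet, det_coordMatrix]
  refine map_coneMeasure hφ (f := conjCoord f) (by rw [conjCoord, LinearMap.det_conj, hf]) hd
    fun p hp => Subtype.ext ?_
  rw [h, coe_toSL hp, coe_toSL (by rwa [hd]), hd, coordMatrix_conjCoord, map_smul]

instance : coneMeasure.IsMulLeftInvariant where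
  map_mul_left_eq_self g :=
    map_coneMeasure_of_linear (continuous_const_mul g).measurable
      (f := LinearMap.mulLeft ℝ (g : Matrix (Fin 2) (Fin 2) ℝ))
      (by rw [det_matrix_mulLeft, g.det_coe, one_pow]) (fun m => by simp) fun h => by simp

instance : coneMeasure.IsMulRightInvariant where
  map_mul_right_eq_self g :=
    map_coneMeasure_of_linear (continuous_mul_const g).measurable
      (f := LinearMap.mulRight ℝ (g : Matrix (Fin 2) (Fin 2) ℝ))
      (by rw [det_matrix_mulRight, g.det_coe, one_pow]) (fun m => by simp) fun h => by simp

instance : coneMeasure.IsOpenPosMeasure where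
  open_pos := by
    rintro U hU ⟨g, hg⟩
    rw [coneMeasure_apply hU.measurableSet]
    have hopen : IsOpen ({p | 0 < detForm p} ∩ toSL ⁻¹' U ∩ {p | detForm p < 1}) :=
      (continuousOn_toSL.isOpen_inter_preimage isOpen_detForm_pos hU).inter
        (isOpen_lt continuous_detForm continuous_const)
    have hvol : (volume : Measure (ℂ × ℂ)).IsOpenPosMeasure :=
      inferInstanceAs ((volume : Measure ℂ).prod volume).IsOpenPosMeasure
    refine fun h0 => (hopen.measure_pos volume ?_).ne' (measure_mono_null ?_ h0)
    · set p : ℂ × ℂ := coordMatrix.symm ((1 / 2 : ℝ) • (g : Matrix (Fin 2) (Fin 2) ℝ)) with hp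
      have hd : detForm p = (1 / 2) ^ 2 := by
        rw [← det_coordMatrix, hp, LinearEquiv.apply_symm_apply, Matrix.det_smul, g.det_coe]
        simp
      have hpos : 0 < detForm p := by rw [hd]; norm_num
      have hpg : toSL p = g := by
        refine Subtype.ext ?_
        rw [coe_toSL hpos, hd, Real.sqrt_sq (by norm_num), hp, LinearEquiv.apply_symm_apply,
          smul_smul]
        norm_num
      refine ⟨p, ⟨hpos, ?_⟩, ?_⟩
      · rwa [Set.mem_preimage, hpg]
      · rw [Set.mem_ofPred_eq, hd]; norm_num
    · rintro p ⟨⟨h1, h2⟩, h3⟩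
      exact ⟨h2, h1, le_of_lt h3⟩

theorem normSq_toSL {p : ℂ × ℂ} (h : 0 < detForm p) :
    normSq (toSL p) = 2 * (‖p.1‖ ^ 2 + ‖p.2‖ ^ 2) / detForm p := by
  have h2 := Real.sq_sqrt h.le
  have h3 := Real.sqrt_pos.mpr h
  simp only [normSq, coe_toSL h, Matrix.smul_apply, smul_eq_mul, mul_pow, inv_pow, h2]
  simp [coordMatrix_apply, Complex.sq_norm, Complex.normSq_apply]
  field_simp
  ring

theorem volume_annulus {a b : ℝ} (ha : 0 ≤ a) (hb : 0 ≤ b) :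
    volume {z : ℂ | a < ‖z‖ ^ 2 ∧ ‖z‖ ^ 2 ≤ b} = ENNReal.ofReal (b - a) * NNReal.pi := by
  rcases lt_or_ge b a with hab | hab
  · rw [ENNReal.ofReal_of_nonpos (by linarith), zero_mul]
    convert measure_empty (μ := (volume : Measure ℂ))
    ext z
    simp only [Set.mem_ofPred_eq, Set.mem_empty_iff_false, iff_false]
    rintro ⟨h1, h2⟩
    linarith
  · have h : {z : ℂ | a < ‖z‖ ^ 2 ∧ ‖z‖ ^ 2 ≤ b} =
        Metric.closedBall 0 √b \ Metric.closedBall 0 √a := by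
      ext z
      simp [Real.le_sqrt (norm_nonneg z), and_comm, ha, hb]
    rw [h, measure_sdiff (Metric.closedBall_subset_closedBall (Real.sqrt_le_sqrt hab))
      Metric.isClosed_closedBall.measurableSet.nullMeasurableSet
      (by simp [Complex.volume_closedBall, ENNReal.mul_eq_top]),
      Complex.volume_closedBall, Complex.volume_closedBall, ← ENNReal.ofReal_pow (by positivity),
      ← ENNReal.ofReal_pow (by positivity), Real.sq_sqrt ha, Real.sq_sqrt hb,
      ENNReal.ofReal_sub _ ha, ENNReal.sub_mul (by simp)]

/-- The constant relating the cone measure to hyperbolic area. -/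
noncomputable def areaConst : ENNReal :=
  ∫⁻ w : ℂ, ENNReal.ofReal (1 - ‖w‖ ^ 2) * NNReal.pi

theorem areaConst_ne_top : areaConst ≠ ⊤ := by
  have h : areaConst ≤ ∫⁻ _ in Metric.closedBall (0 : ℂ) 1, NNReal.pi := by
    rw [← lintegral_indicator Metric.isClosed_closedBall.measurableSet]
    refine lintegral_mono fun w => ?_
    by_cases hw : ‖w‖ ≤ 1
    · rw [Set.indicator_of_mem (by simpa using hw)]
      exact mul_le_of_le_one_left' (ENNReal.ofReal_le_one.mpr (by nlinarith [norm_nonneg w]))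
    · rw [ENNReal.ofReal_of_nonpos (by nlinarith), zero_mul]
      exact zero_le
  refine ne_top_of_le_ne_top ?_ h
  simp [Complex.volume_closedBall, ENNReal.mul_eq_top]

theorem coneMeasure_normSq_lt {s : ℝ} (hs : 1 < s) :
    coneMeasure {g | normSq g < 2 * s} = ENNReal.ofReal ((s - 1) / 2) * areaConst := by
  have hs1 : 0 < s - 1 := by linarith
  have hmeas : MeasurableSet {g | normSq g < 2 * s} :=
    (isOpen_lt continuous_normSq continuous_const).measurableSet
  rw [coneMeasure_apply hmeas, Measure.volume_eq_prod,
    Measure.prod_apply_symm ((measurable_toSL hmeas).inter measurableSet_cone)]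
  set c : ℝ := √(2 / (s - 1)) with hc
  have hc2 : c ^ 2 = 2 / (s - 1) := Real.sq_sqrt (by positivity)
  have hc0 : 0 < c := Real.sqrt_pos.mpr (by positivity)
  have hfib (w : ℂ) : volume ((fun z => (z, w)) ⁻¹' (toSL ⁻¹' {g | normSq g < 2 * s} ∩ cone)) =
      ENNReal.ofReal (1 - ‖c • w‖ ^ 2) * NNReal.pi := by
    have hset : (fun z => (z, w)) ⁻¹' (toSL ⁻¹' {g | normSq g < 2 * s} ∩ cone) =
        {z | (s + 1) / (s - 1) * ‖w‖ ^ 2 < ‖z‖ ^ 2 ∧ ‖z‖ ^ 2 ≤ 1 + ‖w‖ ^ 2} := by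
      ext z
      have key : (s + 1) / (s - 1) * ‖w‖ ^ 2 < ‖z‖ ^ 2 ↔
          (s + 1) * ‖w‖ ^ 2 < ‖z‖ ^ 2 * (s - 1) := by
        rw [div_mul_eq_mul_div, div_lt_iff₀ hs1]
      simp only [cone, Set.mem_preimage, Set.mem_inter_iff, Set.mem_ofPred_eq, key]
      constructor
      · rintro ⟨h1, h2, h3⟩
        rw [normSq_toSL h2, div_lt_iff₀ h2] at h1
        simp only [detForm] at h1 h2 h3
        constructor <;> nlinarith
      · rintro ⟨h1, h3⟩
        have h2 : 0 < detForm (z, w) := by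
          simp only [detForm]
          nlinarith [sq_nonneg ‖w‖]
        rw [normSq_toSL h2, div_lt_iff₀ h2]
        refine ⟨?_, h2, ?_⟩ <;> simp only [detForm] <;> nlinarith
    rw [hset, volume_annulus (by positivity) (by positivity)]
    congr 2
    rw [norm_smul, mul_pow, Real.norm_eq_abs, sq_abs, hc2]
    field_simp
    ring
  simp_rw [hfib]
  have hF : Measurable fun w : ℂ => ENNReal.ofReal (1 - ‖w‖ ^ 2) * (NNReal.pi : ENNReal) := by
    fun_prop
  rw [← lintegral_map (f := fun w : ℂ => ENNReal.ofReal (1 - ‖w‖ ^ 2) * (NNReal.pi : ENNReal))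
    (g := fun w : ℂ => c • w) hF (by fun_prop), Measure.map_addHaar_smul volume hc0.ne',
    lintegral_smul_measure, Complex.finrank_real_complex, hc2, inv_div,
    abs_of_pos (by positivity), areaConst, smul_eq_mul]

theorem areaConst_ne_zero : areaConst ≠ 0 := by
  intro h
  have h1 := coneMeasure_normSq_lt (s := 2) one_lt_two
  rw [h, mul_zero] at h1
  refine ((isOpen_lt continuous_normSq continuous_const).measure_pos coneMeasure ?_).ne' h1
  exact ⟨1, by simp [normSq]; norm_num⟩

instance : IsFiniteMeasureOnCompacts coneMeasure where
  lt_top_of_isCompact K hK := by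
    obtain ⟨C, hC⟩ := (hK.image continuous_normSq).bddAbove
    refine (measure_mono (t := {g | normSq g < 2 * (|C| + 2)}) fun g hg => ?_).trans_lt ?_
    · have := hC ⟨g, hg, rfl⟩
      simp only [Set.mem_ofPred_eq]
      linarith [le_abs_self C, abs_nonneg C]
    · rw [coneMeasure_normSq_lt (by linarith [abs_nonneg C])]
      exact ENNReal.mul_lt_top ENNReal.ofReal_lt_top areaConst_ne_top.lt_top

instance : coneMeasure.IsHaarMeasure where

/-- The Haar measure on `SL(2, ℝ)` for which the set of `g` with `dist (g • I) I < r` has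
measure `sinh² (r / 2)`. -/
noncomputable def normalizedHaar : Measure SL(2, ℝ) := areaConst⁻¹ • coneMeasure

theorem normalizedHaar_dist_lt {r : ℝ} (hr : 0 < r) :
    normalizedHaar {g : SL(2, ℝ) | dist (g • UpperHalfPlane.I) UpperHalfPlane.I < r} =
      ENNReal.ofReal ((Real.cosh r - 1) / 2) := by
  rw [setOf_dist_smul_I_lt hr.le, normalizedHaar, Measure.smul_apply, smul_eq_mul,
    coneMeasure_normSq_lt (Real.one_lt_cosh.mpr hr.ne'), mul_left_comm,
    ENNReal.inv_mul_cancel areaConst_ne_zero areaConst_ne_top, mul_one]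

end SL2Haar

/-- There is a (left and right invariant) Haar measure μ on SL(2,ℝ) such that, with
A_r = {g : d(g·i, i) < r} (hyperbolic distance on the upper half-plane ℍ, i the imaginary
unit), μ(A_r·A_r) ≤ 4·μ(A_r)·(1 + μ(A_r)) for every r > 0. -/
theorem SL2_ball_doubling :
    ∃ μ : Measure SL(2, ℝ), μ.IsHaarMeasure ∧ μ.IsMulRightInvariant ∧
      ∀ r : ℝ, 0 < r →
        μ ({g : SL(2, ℝ) | dist (g • UpperHalfPlane.I) UpperHalfPlane.I < r} *
            {g : SL(2, ℝ) | dist (g • UpperHalfPlane.I) UpperHalfPlane.I < r}) ≤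
          4 * μ {g : SL(2, ℝ) | dist (g • UpperHalfPlane.I) UpperHalfPlane.I < r} *
            (1 + μ {g : SL(2, ℝ) | dist (g • UpperHalfPlane.I) UpperHalfPlane.I < r}) := by
  refine ⟨SL2Haar.normalizedHaar, ?_, ?_, fun r hr => ?_⟩
  · exact Measure.IsHaarMeasure.smul _ (ENNReal.inv_ne_zero.mpr SL2Haar.areaConst_ne_top)
      (ENNReal.inv_ne_top.mpr SL2Haar.areaConst_ne_zero)
  · unfold SL2Haar.normalizedHaar
    infer_instance
  · refine (measure_mono (SL2Haar.setOf_dist_smul_I_lt_mul_self_subset r)).trans_eq ?_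
    have h : 0 ≤ (Real.cosh r - 1) / 2 := by linarith [Real.one_le_cosh r]
    rw [SL2Haar.normalizedHaar_dist_lt hr, SL2Haar.normalizedHaar_dist_lt (by linarith),
      ← ENNReal.ofReal_one, ← ENNReal.ofReal_add zero_le_one h,
      ← ENNReal.ofReal_ofNat, ← ENNReal.ofReal_mul (by norm_num),
      ← ENNReal.ofReal_mul (by positivity), Real.cosh_two_mul, Real.sinh_sq]
    congr 1
    ring
end

section
/- Let 0 < s ≤ 1 be a real number, let I and J be nonempty finite sets, let a : I → [0,∞), b : J → [0,∞), c : I × J → [0,∞), and let C ≥ 0. Suppose that for every β ∈ J, Σ_{α∈I} c(α,β) ≤ C; for every α ∈ I, Σ_{β∈J} c(α,β) ≤ C; and for all (α,β) ∈ I × J, a(α)^s + b(β)^s ≤ c(α,β)^s. Then (Σ_{α∈I} a(α))^s + (Σ_{β∈J} b(β))^s ≤ C^s. -/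
/-- If a weight `N` dominates every `a i * B / ∑ a`, then the bound on a single line of `c`
already controls the full sums. -/
lemma add_rpow_le_of_forall_mul_le {I : Type*} [Fintype I] {s : ℝ} (hs : 0 < s)
    {a c : I → ℝ} {B C N : ℝ} (ha : ∀ i, 0 ≤ a i) (hB : 0 ≤ B) (hc : ∀ i, 0 ≤ c i)
    (hA : 0 < ∑ i, a i) (hN : ∀ i, a i * B ≤ N * ∑ j, a j) (hC : ∑ i, c i ≤ C)
    (hac : ∀ i, a i ^ s + N ^ s ≤ c i ^ s) :
    (∑ i, a i) ^ s + B ^ s ≤ C ^ s := by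
  set A := ∑ i, a i with hAdef
  set D := (A ^ s + B ^ s) ^ s⁻¹ with hD
  have hAB : 0 ≤ A ^ s + B ^ s := by positivity
  have hD₀ : 0 ≤ D := by positivity
  have hDs : D ^ s = A ^ s + B ^ s := Real.rpow_inv_rpow hAB hs.ne'
  have hpoint : ∀ i, a i / A * D ≤ c i := by
    intro i
    have hq : 0 ≤ a i / A := div_nonneg (ha i) hA.le
    have hqN : a i / A * B ≤ N := by
      rw [div_mul_eq_mul_div, div_le_iff₀ hA]
      exact hN i
    refine (Real.rpow_le_rpow_iff (mul_nonneg hq hD₀) (hc i) hs).1 ?_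
    calc (a i / A * D) ^ s = (a i / A * A) ^ s + (a i / A * B) ^ s := by
          rw [Real.mul_rpow hq hD₀, hDs, Real.mul_rpow hq hA.le, Real.mul_rpow hq hB, mul_add]
      _ ≤ a i ^ s + N ^ s := by
          rw [div_mul_cancel₀ _ hA.ne']
          gcongr
      _ ≤ c i ^ s := hac i
  have hDC : D ≤ C := by
    calc D = ∑ i, a i / A * D := by
          rw [← Finset.sum_mul, ← Finset.sum_div, ← hAdef, div_self hA.ne', one_mul]
      _ ≤ ∑ i, c i := Finset.sum_le_sum fun i _ => hpoint i
      _ ≤ C := hC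
  rw [← hDs]
  exact Real.rpow_le_rpow hD₀ hDC hs.le

/-- Combinatorial core of the descent of a Brunn–Minkowski-type bound to coset pieces:
if a(α)^s + b(β)^s ≤ c(α,β)^s pointwise and all row sums and column sums of c are at most C,
then (Σ a)^s + (Σ b)^s ≤ C^s, for any 0 < s ≤ 1. -/
theorem sum_rpow_le_of_pointwise_rpow_le {I J : Type*} [Fintype I] [Fintype J]
    [Nonempty I] [Nonempty J] (s : ℝ) (hs₀ : 0 < s) (hs₁ : s ≤ 1)
    (a : I → ℝ) (b : J → ℝ) (c : I × J → ℝ) (C : ℝ)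
    (ha : ∀ α, 0 ≤ a α) (hb : ∀ β, 0 ≤ b β) (hc : ∀ p, 0 ≤ c p) (hC : 0 ≤ C)
    (hcol : ∀ β, ∑ α, c (α, β) ≤ C) (hrow : ∀ α, ∑ β, c (α, β) ≤ C)
    (hab : ∀ α β, a α ^ s + b β ^ s ≤ c (α, β) ^ s) :
    (∑ α, a α) ^ s + (∑ β, b β) ^ s ≤ C ^ s := by
  obtain ⟨α₀, hα₀⟩ := Finite.exists_max a
  obtain ⟨β₀, hβ₀⟩ := Finite.exists_max b
  have hA : 0 ≤ ∑ α, a α := Finset.sum_nonneg fun α _ => ha α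
  have hB : 0 ≤ ∑ β, b β := Finset.sum_nonneg fun β _ => hb β
  have of_col (hA' : 0 < ∑ α, a α) (h : a α₀ * ∑ β, b β ≤ b β₀ * ∑ α, a α) :
      (∑ α, a α) ^ s + (∑ β, b β) ^ s ≤ C ^ s :=
    add_rpow_le_of_forall_mul_le hs₀ ha hB (fun α => hc (α, β₀)) hA'
      (fun α => (mul_le_mul_of_nonneg_right (hα₀ α) hB).trans h) (hcol β₀)
      (fun α => hab α β₀)
  have of_row (hB' : 0 < ∑ β, b β) (h : b β₀ * ∑ α, a α ≤ a α₀ * ∑ β, b β) :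
      (∑ α, a α) ^ s + (∑ β, b β) ^ s ≤ C ^ s := by
    rw [add_comm]
    exact add_rpow_le_of_forall_mul_le hs₀ hb hA (fun β => hc (α₀, β)) hB'
      (fun β => (mul_le_mul_of_nonneg_right (hβ₀ β) hA).trans h) (hrow α₀)
      (fun β => by rw [add_comm]; exact hab α₀ β)
  rcases hA.eq_or_lt with hA₀ | hA'
  · rcases hB.eq_or_lt with hB₀ | hB'
    · rw [← hA₀, ← hB₀, Real.zero_rpow hs₀.ne', add_zero]
      exact Real.rpow_nonneg hC s
    · refine of_row hB' ?_
      rw [← hA₀, mul_zero]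
      exact mul_nonneg (ha α₀) hB
  · rcases hB.eq_or_lt with hB₀ | hB'
    · refine of_col hA' ?_
      rw [← hB₀, mul_zero]
      exact mul_nonneg (hb β₀) hA
    · exact (le_total _ _).elim (of_col hA') (of_row hB')
end
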